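/- For all n ≥ 1, m ≥ 2 and ℓ_a, ℓ_b ∈ ℕ with 0 < ℓ_b ≤ ℓ_a ≤ m^n and ℓ_a + ℓ_b ≤ m^n, it holds that B(n, ℓ_a + ℓ_b) + σ_{n,m}(ℓ_a, ℓ_b) ≤ B(n, ℓ_a) + B(n, ℓ_b), where σ_{n,m}(ℓ_a, ℓ_b) = q_{n,m}(ℓ_b) + q_{n,m}(ℓ_a + ℓ_b) - q_{n,m}(ℓ_a). -/

import Mathlib

/-- `q n m ℓ = 1 + ⌊(ℓ-1)(m-1)/(mⁿ-1)⌋` for `ℓ ≥ 1`, and `q n m 0 = 0`. -/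
def q (n m ℓ : ℕ) : ℕ := if ℓ = 0 then 0 else 1 + (ℓ - 1) * (m - 1) / (m ^ n - 1)

/-- Recurrence for the edge-boundary of the initial lexicographic segment in `S(n,m)`. -/
def B (m : ℕ) : ℕ → ℕ → ℤ
  | 0, _ => 0
  | n + 1, ℓ =>
    ((ℓ / m ^ n : ℕ) : ℤ) * ((m : ℤ) - (ℓ / m ^ n : ℕ)) + B m n (ℓ % m ^ n) +
      (if q n m (ℓ % m ^ n) ≤ ℓ / m ^ n then -(q n m (ℓ % m ^ n) : ℤ)
       else (q n m (ℓ % m ^ n) : ℤ) - 2 * ((ℓ / m ^ n : ℕ) : ℤ))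

/-- The length `1 + m + ⋯ + m ^ (n - 1)` of the intervals on which `q n m` is constant. -/
def repunit (m : ℕ) : ℕ → ℕ
  | 0 => 0
  | n + 1 => m ^ n + repunit m n

lemma repunit_mul_pred_add_one (m : ℕ) (hm : 2 ≤ m) (n : ℕ) :
    (m - 1) * repunit m n + 1 = m ^ n := by
  obtain ⟨k, rfl⟩ : ∃ k, m = k + 1 := ⟨m - 1, by omega⟩
  induction n with
  | zero => simp [repunit]
  | succ n ih =>
    simp only [repunit, Nat.add_sub_cancel] at ih ⊢
    rw [pow_succ]
    linear_combination ih

lemma repunit_pos {m n : ℕ} (hm : 2 ≤ m) (hn : 1 ≤ n) : 0 < repunit m n := by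
  obtain ⟨k, rfl⟩ : ∃ k, n = k + 1 := ⟨n - 1, by omega⟩
  have : 0 < m ^ k := by positivity
  simp only [repunit]
  omega

@[simp] lemma q_zero (n m : ℕ) : q n m 0 = 0 := by simp [q]

lemma q_le_iff {n m : ℕ} (hm : 2 ≤ m) (hn : 1 ≤ n) (l c : ℕ) :
    q n m l ≤ c ↔ l ≤ c * repunit m n := by
  have hR := repunit_pos hm hn
  have hM := repunit_mul_pred_add_one m hm n
  rcases Nat.eq_zero_or_pos l with rfl | hl
  · simp
  · have h : q n m l = 1 + (l - 1) / repunit m n := by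
      rw [q, if_neg hl.ne', ← hM, Nat.add_sub_cancel, mul_comm (m - 1),
        Nat.mul_div_mul_right _ _ (by omega)]
    rw [h, add_comm, Nat.succ_le_iff, Nat.div_lt_iff_lt_mul hR]
    omega

lemma lt_q_iff {n m : ℕ} (hm : 2 ≤ m) (hn : 1 ≤ n) (l c : ℕ) :
    c < q n m l ↔ c * repunit m n < l := by
  rw [← not_le, q_le_iff hm hn, not_le]

lemma q_pos {n m l : ℕ} (hm : 2 ≤ m) (hn : 1 ≤ n) (hl : 0 < l) : 0 < q n m l := by
  rw [lt_q_iff hm hn]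
  simpa using hl

lemma q_lt_of_lt_pow {n m l : ℕ} (hm : 2 ≤ m) (hn : 1 ≤ n) (hl : l < m ^ n) : q n m l < m := by
  have h : q n m l ≤ m - 1 := by
    rw [q_le_iff hm hn]
    have := repunit_mul_pred_add_one m hm n
    omega
  omega

lemma q_add_le {n m : ℕ} (hm : 2 ≤ m) (hn : 1 ≤ n) (a b : ℕ) :
    q n m (a + b) ≤ q n m a + q n m b := by
  have ha := (q_le_iff hm hn a _).1 le_rfl
  have hb := (q_le_iff hm hn b _).1 le_rfl
  rw [q_le_iff hm hn, add_mul]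
  omega

lemma q_add_q_le {n m a b : ℕ} (hm : 2 ≤ m) (hn : 1 ≤ n) (ha : 0 < a) (hb : 0 < b) :
    q n m a + q n m b ≤ q n m (a + b) + 1 := by
  obtain ⟨x, hx⟩ := Nat.exists_eq_succ_of_ne_zero (q_pos hm hn ha).ne'
  obtain ⟨y, hy⟩ := Nat.exists_eq_succ_of_ne_zero (q_pos hm hn hb).ne'
  have ha' := (lt_q_iff hm hn a x).1 (by omega)
  have hb' := (lt_q_iff hm hn b y).1 (by omega)
  have h : x + y < q n m (a + b) := by
    rw [lt_q_iff hm hn, add_mul]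
    omega
  omega

lemma q_carry {n m a b d : ℕ} (hm : 2 ≤ m) (hn : 1 ≤ n) (ha : 0 < a) (hb : 0 < b)
    (hd : d + m ^ n = a + b) :
    q n m a + q n m b ≤ q n m d + m ∧ q n m d + m ≤ q n m a + q n m b + 1 := by
  have hM := repunit_mul_pred_add_one m hm n
  have ha₁ := (q_le_iff hm hn a _).1 le_rfl
  have hb₁ := (q_le_iff hm hn b _).1 le_rfl
  have hsum : m - 1 < q n m a + q n m b := by
    refine lt_of_mul_lt_mul_right (a := repunit m n) ?_ (Nat.zero_le _)
    rw [add_mul]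
    omega
  obtain ⟨x, hx⟩ := Nat.exists_eq_succ_of_ne_zero (q_pos hm hn ha).ne'
  obtain ⟨y, hy⟩ := Nat.exists_eq_succ_of_ne_zero (q_pos hm hn hb).ne'
  have ha₂ := (lt_q_iff hm hn a x).1 (by omega)
  have hb₂ := (lt_q_iff hm hn b y).1 (by omega)
  obtain ⟨e, he⟩ : ∃ e, q n m a + q n m b = m + e := ⟨_, (Nat.add_sub_of_le (by omega)).symm⟩
  have hmul : (q n m a + q n m b) * repunit m n =
      (m - 1) * repunit m n + (e + 1) * repunit m n := by
    rw [he, ← add_mul]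
    congr 1
    omega
  constructor
  · rcases Nat.eq_zero_or_pos e with h0 | h0
    · omega
    · have h : e - 1 < q n m d := by
        rw [lt_q_iff hm hn]
        have h₁ : (x + y) * repunit m n = (m - 1) * repunit m n + (e - 1) * repunit m n := by
          rw [← add_mul]
          congr 1
          omega
        rw [add_mul] at h₁
        omega
      omega
  · have h : q n m d ≤ e + 1 := by
      rw [q_le_iff hm hn]
      rw [add_mul] at hmul
      omega
    omega

lemma q_succ {n m k a : ℕ} (hm : 2 ≤ m) (hn : 1 ≤ n) (ha : a < m ^ n) (hk : k ≤ m) :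
    q (n + 1) m (k * m ^ n + a) = k + if k < q n m a then 1 else 0 := by
  have hM := repunit_mul_pred_add_one m hm n
  have hR : repunit m (n + 1) = m ^ n + repunit m n := rfl
  have key : ∀ c, q (n + 1) m (k * m ^ n + a) ≤ c ↔
      (k + if k < q n m a then 1 else 0) ≤ c := by
    intro c
    rw [q_le_iff hm (by omega), hR, mul_add]
    rcases lt_trichotomy c k with h | rfl | h
    · have h₁ : (c + 1) * m ^ n ≤ k * m ^ n := Nat.mul_le_mul_right _ h
      have h₂ : c * repunit m n ≤ (m - 1) * repunit m n := Nat.mul_le_mul_right _ (by omega)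
      rw [add_mul, one_mul] at h₁
      constructor <;> intro <;> split_ifs at * <;> omega
    · have h := lt_q_iff hm hn a c
      split_ifs <;> omega
    · have h₁ : (k + 1) * m ^ n ≤ c * m ^ n := Nat.mul_le_mul_right _ h
      rw [add_mul, one_mul] at h₁
      constructor <;> intro <;> split_ifs at * <;> omega
  exact le_antisymm ((key _).2 le_rfl) ((key _).1 le_rfl)

lemma B_succ {n m k a : ℕ} (ha : a < m ^ n) :
    B m (n + 1) (k * m ^ n + a) =
      (k : ℤ) * (m - 1 - k) + |(q n m a : ℤ) - k| + B m n a := by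
  have h₁ : (k * m ^ n + a) / m ^ n = k := by
    rw [mul_comm, Nat.mul_add_div (by omega), Nat.div_eq_of_lt ha, add_zero]
  have h₂ : (k * m ^ n + a) % m ^ n = a := by
    rw [mul_comm, Nat.mul_add_mod, Nat.mod_eq_of_lt ha]
  rw [B, h₁, h₂]
  split_ifs with h
  · rw [abs_of_nonpos (by omega)]
    ring
  · rw [abs_of_nonneg (by omega)]
    ring

lemma B_one (m l : ℕ) : B m 1 l = (l : ℤ) * (m - l) := by
  simp [B, Nat.mod_one]

lemma q_one {m : ℕ} (hm : 2 ≤ m) (l : ℕ) : q 1 m l = l := by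
  have h := fun c => q_le_iff hm le_rfl l c
  simp only [repunit, pow_zero, add_zero, mul_one] at h
  exact le_antisymm ((h _).2 le_rfl) ((h _).1 le_rfl)

lemma mul_eq_zero_or_add_le {x y : ℤ} (hx : 0 ≤ x) (hy : 0 ≤ y) :
    x = 0 ∧ x * y = 0 ∨ y = 0 ∧ x * y = 0 ∨ x = 1 ∧ x * y = y ∨ y = 1 ∧ x * y = x ∨
      2 ≤ x ∧ 2 ≤ y ∧ 2 * x + 2 * y - 4 ≤ x * y := by
  by_cases h₁ : x = 0
  · simp [h₁]
  by_cases h₂ : y = 0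
  · simp [h₂]
  by_cases h₃ : x = 1
  · simp [h₃]
  by_cases h₄ : y = 1
  · simp [h₄]
  have hx' : 2 ≤ x := by omega
  have hy' : 2 ≤ y := by omega
  exact .inr (.inr (.inr (.inr ⟨hx', hy', by nlinarith⟩)))

/-- The corner count of a segment with leading digit `k` whose lower part has corner count `u`. -/
def corner (k u : ℤ) : ℤ := k + if k < u then 1 else 0

lemma corner_cases (k u : ℤ) :
    u ≤ k ∧ corner k u = k ∧ |u - k| = k - u ∨ k < u ∧ corner k u = k + 1 ∧ |u - k| = u - k := by
  rcases le_or_gt u k with h | h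
  · exact .inl ⟨h, by simp [corner, h], by rw [abs_of_nonpos (by omega)]; ring⟩
  · exact .inr ⟨h, by simp [corner, h], abs_of_pos (by omega)⟩

/-- The defect allowed in the subadditivity of complements. -/
def defect (m u v s : ℤ) : ℤ := if u = m - 1 ∧ s = v ∨ v = m - 1 ∧ s = u then 1 else 0

lemma digit_add {i j u v s : ℤ} (hi : 0 ≤ i) (hj : 0 ≤ j) (hu : 0 ≤ u) (hv : 0 ≤ v)
    (hs : s = u + v ∨ (0 < u ∧ 0 < v) ∧ s = u + v - 1) :
    |s - (i + j)| + corner (i + j) s + |u - v| - s ≤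
      2 * (i * j) + |u - i| + |v - j| + |corner i u - corner j v| := by
  have hP := mul_eq_zero_or_add_le hi hj
  generalize i * j = P at hP ⊢
  have a₁ := le_abs_self (corner i u - corner j v)
  have a₂ := neg_le_abs (corner i u - corner j v)
  generalize |corner i u - corner j v| = Z at a₁ a₂ ⊢
  rcases corner_cases (i + j) s with ⟨h₁, e₁, f₁⟩ | ⟨h₁, e₁, f₁⟩ <;>
    rcases corner_cases i u with ⟨h₂, e₂, f₂⟩ | ⟨h₂, e₂, f₂⟩ <;>
    rcases corner_cases j v with ⟨h₃, e₃, f₃⟩ | ⟨h₃, e₃, f₃⟩ <;>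
    rw [e₂, e₃] at a₁ a₂ <;> rw [e₁, f₁, f₂, f₃] <;> clear e₁ f₁ e₂ f₂ e₃ f₃ <;>
    rcases abs_cases (u - v) with ⟨h₅, h₆⟩ | ⟨h₅, h₆⟩ <;> rw [h₅] <;> clear h₅ <;>
    rcases hs with rfl | hs <;> rcases hP with hP | hP | hP | hP | hP <;> omega

lemma digit_add_wrap {i j u v s m : ℤ} (him : i ≤ m) (hjm : j ≤ m) (hk : m ≤ i + j)
    (hiu : i = m → u = 0) (hjv : j = m → v = 0) (hm : 2 ≤ m)
    (hu : 0 ≤ u) (hv : 0 ≤ v) (hum : u < m) (hvm : v < m) (hsm : s < m)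
    (hs : s = u + v ∨ (0 < u ∧ 0 < v) ∧ s = u + v - 1) :
    |s - (i + j - m)| + (m - corner (i + j - m) s) + |u - v| - s ≤
      2 * ((m - i) * (m - j)) - m + |u - i| + |v - j| + |corner i u - corner j v| +
        defect m (corner i u) (corner j v) (corner (i + j - m) s) := by
  have hP := mul_eq_zero_or_add_le (sub_nonneg.2 him) (sub_nonneg.2 hjm)
  generalize (m - i) * (m - j) = P at hP ⊢
  have a₁ := le_abs_self (corner i u - corner j v)
  have a₂ := neg_le_abs (corner i u - corner j v)
  generalize |corner i u - corner j v| = Z at a₁ a₂ ⊢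
  rcases corner_cases (i + j - m) s with ⟨h₁, e₁, f₁⟩ | ⟨h₁, e₁, f₁⟩ <;>
    rcases corner_cases i u with ⟨h₂, e₂, f₂⟩ | ⟨h₂, e₂, f₂⟩ <;>
    rcases corner_cases j v with ⟨h₃, e₃, f₃⟩ | ⟨h₃, e₃, f₃⟩ <;>
    rw [e₂, e₃] at a₁ a₂ <;> rw [e₁, f₁, f₂, f₃, e₂, e₃] <;> clear e₁ f₁ e₂ f₂ e₃ f₃ <;>
    rcases abs_cases (u - v) with ⟨h₅, h₆⟩ | ⟨h₅, h₆⟩ <;> rw [h₅] <;> clear h₅ <;>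
    rcases hs with rfl | hs <;> unfold defect <;> split_ifs <;>
    rcases hP with hP | hP | hP | hP | hP <;> omega

lemma digit_carry {i j u v s m : ℤ} (hi : 0 ≤ i) (hj : 0 ≤ j) (hk : i + j + 1 ≤ m)
    (hu : 0 < u) (hv : 0 < v) (hum : u < m) (hvm : v < m) (hs0 : 0 ≤ s)
    (hs : s = u + v - m ∨ s = u + v - m + 1) :
    |s - (i + j + 1)| + corner (i + j + 1) s + |u - v| + defect m u v s + s ≤
      2 * ((i + 1) * (j + 1)) + |u - i| + |v - j| + |corner i u - corner j v| := by
  have hP := mul_eq_zero_or_add_le (show 0 ≤ i + 1 by omega) (show 0 ≤ j + 1 by omega)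
  generalize (i + 1) * (j + 1) = P at hP ⊢
  have a₁ := le_abs_self (corner i u - corner j v)
  have a₂ := neg_le_abs (corner i u - corner j v)
  generalize |corner i u - corner j v| = Z at a₁ a₂ ⊢
  rcases corner_cases (i + j + 1) s with ⟨h₁, e₁, f₁⟩ | ⟨h₁, e₁, f₁⟩ <;>
    rcases corner_cases i u with ⟨h₂, e₂, f₂⟩ | ⟨h₂, e₂, f₂⟩ <;>
    rcases corner_cases j v with ⟨h₃, e₃, f₃⟩ | ⟨h₃, e₃, f₃⟩ <;>
    rw [e₂, e₃] at a₁ a₂ <;> rw [e₁, f₁, f₂, f₃] <;> clear e₁ f₁ e₂ f₂ e₃ f₃ <;>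
    rcases abs_cases (u - v) with ⟨h₅, h₆⟩ | ⟨h₅, h₆⟩ <;> rw [h₅] <;> clear h₅ <;>
    rcases hs with rfl | hs <;> unfold defect <;> split_ifs <;>
    rcases hP with hP | hP | hP | hP | hP <;> omega

lemma digit_carry_wrap {i j u v s m : ℤ} (him : i < m) (hjm : j < m)
    (hum : u < m) (hvm : v < m) (hs0 : 0 ≤ s) (hsm : s < m)
    (hs : s = u + v - m ∨ s = u + v - m + 1) :
    |s - (i + j + 1 - m)| - corner (i + j + 1 - m) s + |u - v| + defect m u v s + s ≤
      2 * ((m - 1 - i) * (m - 1 - j)) + |u - i| + |v - j| + |corner i u - corner j v| +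
        defect m (corner i u) (corner j v) (corner (i + j + 1 - m) s) := by
  have hP := mul_eq_zero_or_add_le (show 0 ≤ m - 1 - i by omega) (show 0 ≤ m - 1 - j by omega)
  generalize (m - 1 - i) * (m - 1 - j) = P at hP ⊢
  have a₁ := le_abs_self (corner i u - corner j v)
  have a₂ := neg_le_abs (corner i u - corner j v)
  generalize |corner i u - corner j v| = Z at a₁ a₂ ⊢
  rcases corner_cases (i + j + 1 - m) s with ⟨h₁, e₁, f₁⟩ | ⟨h₁, e₁, f₁⟩ <;>
    rcases corner_cases i u with ⟨h₂, e₂, f₂⟩ | ⟨h₂, e₂, f₂⟩ <;>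
    rcases corner_cases j v with ⟨h₃, e₃, f₃⟩ | ⟨h₃, e₃, f₃⟩ <;>
    rw [e₂, e₃] at a₁ a₂ <;> rw [e₁, f₁, f₂, f₃, e₂, e₃] <;> clear e₁ f₁ e₂ f₂ e₃ f₃ <;>
    rcases abs_cases (u - v) with ⟨h₅, h₆⟩ | ⟨h₅, h₆⟩ <;> rw [h₅] <;> clear h₅ <;>
    rcases hs with rfl | hs <;> unfold defect <;> split_ifs <;>
    rcases hP with hP | hP | hP | hP | hP <;> omega
lemma corner_q {n m k a : ℕ} (hm : 2 ≤ m) (hn : 1 ≤ n) (ha : a < m ^ n) (hk : k ≤ m) :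
    (q (n + 1) m (k * m ^ n + a) : ℤ) = corner k (q n m a) := by
  rw [q_succ hm hn ha hk, corner]
  push_cast
  simp

lemma digits_of_le_pow_succ {n m l : ℕ} (hm : 2 ≤ m) (hl : l ≤ m ^ (n + 1)) :
    ∃ k a, l = k * m ^ n + a ∧ a < m ^ n ∧ k ≤ m ∧ (k = m → a = 0) := by
  have hM : 0 < m ^ n := by positivity
  have h := Nat.div_add_mod' l (m ^ n)
  rw [pow_succ, mul_comm] at hl
  refine ⟨l / m ^ n, l % m ^ n, h.symm, Nat.mod_lt _ hM, Nat.div_le_of_le_mul ?_, fun hk => ?_⟩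
  · rwa [mul_comm]
  · rw [hk] at h
    exact Nat.le_zero.1 (by linarith)

lemma le_of_mul_add_le_mul_add {M k a m b : ℕ} (hb : b < M) (h : k * M + a ≤ m * M + b) :
    k ≤ m := by
  by_contra! hlt
  have := Nat.mul_le_mul_right M hlt
  rw [Nat.succ_mul] at this
  omega

theorem B_subadditive {n m : ℕ} (hm : 2 ≤ m) (hn : 1 ≤ n) {a b : ℕ} (ha : a ≤ m ^ n)
    (hb : b ≤ m ^ n) :
    (a + b ≤ m ^ n → B m n (a + b) + q n m (a + b) ≤
      B m n a + B m n b + |(q n m a : ℤ) - q n m b|) ∧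
    (∀ d, d + m ^ n = a + b → B m n d + (m - q n m d) ≤
      B m n a + B m n b + |(q n m a : ℤ) - q n m b| +
        defect m (q n m a) (q n m b) (q n m d)) := by
  induction n, hn using Nat.le_induction generalizing a b with
  | base =>
    simp only [B_one, q_one hm, pow_one] at *
    have hdef : ∀ u v s : ℤ, 0 ≤ defect m u v s := by
      intro u v s
      unfold defect
      split_ifs <;> norm_num
    constructor
    · intro h
      push_cast
      rcases mul_eq_zero_or_add_le (Int.natCast_nonneg a) (Int.natCast_nonneg b) with
        h | h | h | h | h <;> rcases abs_cases ((a : ℤ) - b) with h' | h' <;> nlinarith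
    · intro d hd
      have hd' : (d : ℤ) = a + b - m := by omega
      have := hdef a b d
      rw [hd'] at this ⊢
      have h₁ : (0 : ℤ) ≤ m - a := by omega
      have h₂ : (0 : ℤ) ≤ m - b := by omega
      rcases mul_eq_zero_or_add_le h₁ h₂ with
        h | h | h | h | h <;> rcases abs_cases ((a : ℤ) - b) with h' | h' <;> nlinarith
  | succ n hn ih =>
    obtain ⟨i, x, rfl, hx, hi, hix⟩ := digits_of_le_pow_succ hm ha
    obtain ⟨j, y, rfl, hy, hj, hjy⟩ := digits_of_le_pow_succ hm hb
    have ih := ih hx.le hy.le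
    have hu := q_lt_of_lt_pow hm hn hx
    have hv := q_lt_of_lt_pow hm hn hy
    have hiu : i = m → q n m x = 0 := fun h => by simp [hix h]
    have hjv : j = m → q n m y = 0 := fun h => by simp [hjy h]
    have hpow : m ^ (n + 1) = m * m ^ n := by rw [pow_succ, mul_comm]
    have hM : 0 < m ^ n := by positivity
    rcases lt_or_ge (x + y) (m ^ n) with hxy | hxy
    · have ih := ih.1 hxy.le
      have hs := q_lt_of_lt_pow hm hn hxy
      have hs' : q n m (x + y) = q n m x + q n m y ∨
          (0 < q n m x ∧ 0 < q n m y) ∧ q n m (x + y) = q n m x + q n m y - 1 := by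
        rcases Nat.eq_zero_or_pos x with rfl | hx0
        · simp
        rcases Nat.eq_zero_or_pos y with rfl | hy0
        · simp
        have h₁ := q_add_le hm hn x y
        have h₂ := q_add_q_le hm hn hx0 hy0
        have h₃ := q_pos hm hn hx0
        have h₄ := q_pos hm hn hy0
        omega
      constructor
      · intro h
        have e : i * m ^ n + x + (j * m ^ n + y) = (i + j) * m ^ n + (x + y) := by ring
        rw [e] at h ⊢
        have hk : i + j ≤ m := le_of_mul_add_le_mul_add hM (by rw [hpow] at h; exact h)
        rw [B_succ hx, B_succ hy, B_succ hxy, corner_q hm hn hx hi, corner_q hm hn hy hj,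
          corner_q hm hn hxy hk]
        have key := digit_add (i := i) (j := j) (u := q n m x) (v := q n m y)
          (s := q n m (x + y)) (by omega) (by omega) (by omega) (by omega) (by omega)
        push_cast
        linarith
      · intro d hd
        obtain ⟨k, hk⟩ : ∃ k, i + j = m + k := by
          refine ⟨_, (Nat.add_sub_of_le ?_).symm⟩
          refine le_of_mul_add_le_mul_add (a := d) hxy ?_
          rw [hpow] at hd
          rw [add_mul]
          omega
        obtain rfl : d = k * m ^ n + (x + y) := by
          have : (i + j) * m ^ n = (m + k) * m ^ n := by rw [hk]
          rw [add_mul, add_mul] at this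
          rw [hpow] at hd
          omega
        have hk' : (k : ℤ) = i + j - m := by omega
        rw [B_succ hx, B_succ hy, B_succ hxy, corner_q hm hn hx hi, corner_q hm hn hy hj,
          corner_q hm hn hxy (by omega), hk']
        have key := digit_add_wrap (i := i) (j := j) (u := q n m x) (v := q n m y)
          (s := q n m (x + y)) (m := m) (by omega) (by omega) (by omega) (by omega) (by omega)
          (by omega) (by omega) (by omega) (by omega) (by omega) (by omega) (by omega)
        linarith
    · obtain ⟨d, hd⟩ : ∃ d, d + m ^ n = x + y := ⟨_, Nat.sub_add_cancel hxy⟩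
      have ih := ih.2 d hd
      have hdM : d < m ^ n := by omega
      have hs := q_lt_of_lt_pow hm hn hdM
      have hx0 : 0 < x := by omega
      have hy0 : 0 < y := by omega
      have hs' := q_carry hm hn hx0 hy0 hd
      have hu0 := q_pos hm hn hx0
      have hv0 := q_pos hm hn hy0
      have him : i < m := lt_of_le_of_ne hi fun h => by omega
      have hjm : j < m := lt_of_le_of_ne hj fun h => by omega
      have e : i * m ^ n + x + (j * m ^ n + y) = (i + j + 1) * m ^ n + d := by
        rw [add_mul, add_mul]
        omega
      rw [e]
      constructor
      · intro h
        rw [hpow] at h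
        have hk : i + j + 1 ≤ m := le_of_mul_add_le_mul_add hM h
        have hks : i + j + 1 = m → q n m d = 0 := fun hk => by
          rw [hk] at h
          simp [show d = 0 by omega]
        rw [B_succ hx, B_succ hy, B_succ hdM, corner_q hm hn hx hi, corner_q hm hn hy hj,
          corner_q hm hn hdM hk]
        have key := digit_carry (i := i) (j := j) (u := q n m x) (v := q n m y)
          (s := q n m d) (m := m) (by omega) (by omega) (by omega) (by omega) (by omega)
          (by omega) (by omega) (by omega) (by omega)
        push_cast
        linarith
      · intro c hc
        rw [hpow] at hc
        obtain ⟨k, hk⟩ : ∃ k, i + j + 1 = m + k :=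
          ⟨_, (Nat.add_sub_of_le (le_of_mul_add_le_mul_add (a := c) hdM (by omega))).symm⟩
        obtain rfl : c = k * m ^ n + d := by
          rw [hk, add_mul] at hc
          omega
        have hk' : (k : ℤ) = i + j + 1 - m := by omega
        rw [B_succ hx, B_succ hy, B_succ hdM, corner_q hm hn hx hi, corner_q hm hn hy hj,
          corner_q hm hn hdM (by omega), hk']
        have key := digit_carry_wrap (i := i) (j := j) (u := q n m x) (v := q n m y)
          (s := q n m d) (m := m) (by omega) (by omega) (by omega) (by omega) (by omega)
          (by omega) (by omega)
        linarith

lemma q_mono {n m a b : ℕ} (hm : 2 ≤ m) (hn : 1 ≤ n) (h : a ≤ b) : q n m a ≤ q n m b :=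
  (q_le_iff hm hn a _).2 (h.trans ((q_le_iff hm hn b _).1 le_rfl))

theorem stmt12 (n m ℓa ℓb : ℕ) (hn : 1 ≤ n) (hm : 2 ≤ m)
    (hb : 0 < ℓb) (hba : ℓb ≤ ℓa) (ha : ℓa ≤ m ^ n) (hab : ℓa + ℓb ≤ m ^ n) :
    B m n (ℓa + ℓb) + ((q n m ℓb : ℤ) + (q n m (ℓa + ℓb) : ℤ) - (q n m ℓa : ℤ))
      ≤ B m n ℓa + B m n ℓb := by
  have h := (B_subadditive hm hn ha (hba.trans ha)).1 hab
  have hq := q_mono hm hn hba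
  rw [abs_of_nonneg (by omega)] at h
  linarith
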